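/- Let G1, G2, G3 be FDESs over the same finite event set E. If G1 ⊆ G2, then G3 || G1 ⊆ G3 || G2, i.e., parallel composition is monotone with respect to the fuzzy simulation preorder. -/

import Mathlib

open unitInterval

/-- A fuzzy discrete event system (FDES) over event set `E` with crisp state
index type `S`: fuzzy initial state vector, fuzzy marked state vector, and an
`S × S` fuzzy event matrix for each event, with entries in `[0,1]`. -/
structure FDES (E : Type) (S : Type) where
  x0 : S → unitInterval
  xm : S → unitInterval
  sig : E → S → S → unitInterval

/-- Max-min product of matrices over `[0,1]`. -/
noncomputable def maxmin {α β γ : Type} [Fintype β]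
    (A : α → β → unitInterval) (B : β → γ → unitInterval) : α → γ → unitInterval :=
  fun i k => Finset.univ.sup fun j => A i j ⊓ B j k

/-- Max-min product of a (row) vector with a matrix. -/
noncomputable def vecMat {β γ : Type} [Fintype β]
    (x : β → unitInterval) (B : β → γ → unitInterval) : γ → unitInterval :=
  fun k => Finset.univ.sup fun j => x j ⊓ B j k

/-- `φ` is a fuzzy simulation from `G1` to `G2`:
(a) `x01 ≤ x02 ⊙ φᵀ`, (b) `xm1 ⊙ φ ≤ xm2`, (c) `φᵀ ⊙ σ1(e) ≤ σ2(e) ⊙ φᵀ` for all `e`. -/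
def IsFuzzySim {E S1 S2 : Type} [Fintype S1] [Fintype S2]
    (G1 : FDES E S1) (G2 : FDES E S2) (φ : S1 → S2 → unitInterval) : Prop :=
  (∀ i, G1.x0 i ≤ Finset.univ.sup fun j => G2.x0 j ⊓ φ i j) ∧
  (∀ j, (Finset.univ.sup fun i => G1.xm i ⊓ φ i j) ≤ G2.xm j) ∧
  (∀ e : E, ∀ j i, (Finset.univ.sup fun i' => φ i' j ⊓ G1.sig e i' i)
      ≤ Finset.univ.sup fun j' => G2.sig e j j' ⊓ φ i j')

/-- `G1 ⊆ G2`: some fuzzy simulation from `G1` to `G2` exists. -/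
def Sim {E S1 S2 : Type} [Fintype S1] [Fintype S2]
    (G1 : FDES E S1) (G2 : FDES E S2) : Prop :=
  ∃ φ, IsFuzzySim G1 G2 φ

/-- Fuzzy tensor of two matrices over `[0,1]`. -/
noncomputable def ftensor {α β γ δ : Type} (A : α → β → unitInterval) (B : γ → δ → unitInterval) :
    α × γ → β × δ → unitInterval :=
  fun p q => A p.1 q.1 ⊓ B p.2 q.2

/-- Parallel composition of two FDESs over the same event set. -/
noncomputable def par {E S1 S2 : Type} (G1 : FDES E S1) (G2 : FDES E S2) : FDES E (S1 × S2) where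
  x0 := fun p => G1.x0 p.1 ⊓ G2.x0 p.2
  xm := fun p => G1.xm p.1 ⊓ G2.xm p.2
  sig := fun e => ftensor (G1.sig e) (G2.sig e)

/-- The fuzzy state vector reached after executing the word `s`. -/
noncomputable def run {E S : Type} [Fintype S] (G : FDES E S) (s : List E) : S → unitInterval :=
  s.foldl (fun v e => vecMat v (G.sig e)) G.x0

/-- The fuzzy language generated by `G`. -/
noncomputable def lang {E S : Type} [Fintype S] (G : FDES E S) : List E → unitInterval
  | [] => 1
  | e :: s => Finset.univ.sup fun i => run G (e :: s) i

/-- `S` is fuzzy `Suc`-compatible: every row of every event matrix has an entry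
at least the degree of uncontrollability of that event. -/
def Compatible {E S : Type} [Fintype S] (G : FDES E S) (Suc : E → unitInterval) : Prop :=
  ∀ (e : E) (i : S), Suc e ≤ Finset.univ.sup fun j => G.sig e i j

/-- The augmented FDES `R⁺` obtained from `R` by adding one extra crisp state
(`none`), following Algorithm 1. -/
noncomputable def Rplus {E S : Type} [Fintype S] (R : FDES E S) (Suc : E → unitInterval) :
    FDES E (Option S) where
  x0 := fun s => match s with | some i => R.x0 i | none => 0
  xm := fun s => match s with | some i => R.xm i | none => 0
  sig := fun e p q => match p, q with
    | some i, some j => R.sig e i j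
    | none, some _ => 0
    | none, none => Suc e
    | some i, none =>
        if Suc e ≤ Finset.univ.sup (fun j => R.sig e i j) then 0 else Suc e

/-- The tensor of the crisp identity relation with a fuzzy relation. -/
noncomputable def idTensor {α β γ : Type} (φ : β → γ → unitInterval) :
    α × β → α × γ → unitInterval :=
  open Classical in fun p q => if p.1 = q.1 then φ p.2 q.2 else ⊥

theorem idTensor_mk_self {α β γ : Type} (φ : β → γ → unitInterval) (a : α) (b : β) (c : γ) :
    idTensor φ (a, b) (a, c) = φ b c := by
  simp [idTensor]

theorem idTensor_of_ne {α β γ : Type} (φ : β → γ → unitInterval) {p : α × β} {q : α × γ}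
    (h : p.1 ≠ q.1) : idTensor φ p q = ⊥ := by
  simp [idTensor, h]

theorem IsFuzzySim.par_left {E S1 S2 S3 : Type} [Fintype S1] [Fintype S2] [Fintype S3]
    {G1 : FDES E S1} {G2 : FDES E S2} {φ : S1 → S2 → unitInterval}
    (h : IsFuzzySim G1 G2 φ) (G3 : FDES E S3) :
    IsFuzzySim (par G3 G1) (par G3 G2) (idTensor φ) := by
  obtain ⟨h_init, h_mark, h_step⟩ := h
  refine ⟨?_, ?_, ?_⟩
  · rintro ⟨a, i⟩
    refine (inf_le_inf_left (G3.x0 a) (h_init i)).trans ?_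
    rw [Finset.sup_inf_distrib_left]
    refine Finset.sup_le fun j _ => ?_
    refine le_trans ?_ (Finset.le_sup (Finset.mem_univ (a, j)))
    simp only [par, idTensor_mk_self, inf_assoc, le_refl]
  · rintro ⟨a, j⟩
    refine Finset.sup_le ?_
    rintro ⟨b, i⟩ -
    by_cases hba : b = a
    · subst hba
      simp only [par, idTensor_mk_self, inf_assoc]
      exact inf_le_inf_left _
        ((Finset.le_sup (f := fun i => G1.xm i ⊓ φ i j) (Finset.mem_univ i)).trans (h_mark j))
    · rw [idTensor_of_ne φ hba, inf_bot_eq]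
      exact bot_le
  · rintro e ⟨a, j⟩ ⟨c, i⟩
    refine Finset.sup_le ?_
    rintro ⟨b, k⟩ -
    by_cases hba : b = a
    · subst hba
      simp only [par, ftensor, idTensor_mk_self, inf_left_comm (φ k j)]
      refine (inf_le_inf_left _ ((Finset.le_sup (f := fun k => φ k j ⊓ G1.sig e k i)
        (Finset.mem_univ k)).trans (h_step e j i))).trans ?_
      rw [Finset.sup_inf_distrib_left]
      refine Finset.sup_le fun l _ => ?_
      refine le_trans ?_ (Finset.le_sup (Finset.mem_univ (c, l)))
      simp only [idTensor_mk_self, inf_assoc, le_refl]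
    · rw [idTensor_of_ne φ hba, bot_inf_eq]
      exact bot_le

/-- parallel composition is monotone with respect to the fuzzy
simulation preorder. -/
theorem stmt_8 {E S1 S2 S3 : Type} [Fintype E] [Fintype S1] [Fintype S2] [Fintype S3]
    (G1 : FDES E S1) (G2 : FDES E S2) (G3 : FDES E S3)
    (h : Sim G1 G2) : Sim (par G3 G1) (par G3 G2) := by
  obtain ⟨φ, hφ⟩ := h
  exact ⟨idTensor φ, hφ.par_left G3⟩
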